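/- arXiv:1109.1548 — 2 statements merged into one kernel-verified Lean document; each statement's English description precedes it below -/
import Mathlib

section
/- Let L be a finite-dimensional semi-simple Lie algebra over a field of characteristic zero and J a Lie-orthogonal operator on L. Then J² = Id; equivalently, the polynomial t² − 1 annihilates J. Moreover, [Jx, y] = [x, Jy] for all x, y ∈ L. -/
theorem lieOrthogonal_semisimple_sq_eq_id {k L : Type*} [Field k] [CharZero k]
    [LieRing L] [LieAlgebra k L] [FiniteDimensional k L]
    [LieAlgebra.IsSemisimple k L]
    (J : L →ₗ[k] L) (hJ : ∀ x y : L, ⁅J x, J y⁆ = ⁅x, y⁆) :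
    J.comp J = LinearMap.id ∧ ∀ x y : L, ⁅J x, y⁆ = ⁅x, J y⁆ := by
  have hK : LieAlgebra.IsKilling k L := inferInstance
  have hker := LieAlgebra.IsKilling.ker_killingForm_eq_bot k L
  -- the Killing form separates points
  have sep : ∀ u v : L, (∀ w, killingForm k L u w = killingForm k L v w) → u = v := by
    intro u v h
    rw [LinearMap.ker_eq_bot] at hker
    exact hker (LinearMap.ext h)
  -- the center is trivial
  have cen : ∀ u v : L, (∀ w : L, ⁅u, w⁆ = ⁅v, w⁆) → u = v := by
    intro u v h
    have hmem : u - v ∈ LieAlgebra.center k L := by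
      rw [LieModule.mem_maxTrivSubmodule]
      intro w
      rw [← lie_skew, sub_lie, h w, sub_self, neg_zero]
    rw [LieAlgebra.center_eq_bot, LieSubmodule.mem_bot] at hmem
    exact sub_eq_zero.mp hmem
  have hinj : Function.Injective J := by
    intro u v h
    apply cen
    intro w
    rw [← hJ u, ← hJ v, h]
  have hsurj : Function.Surjective J := LinearMap.injective_iff_surjective.mp hinj
  -- `ad y ∘ J` agrees with `J* ∘ ad y`
  have key : ∀ y z w : L, killingForm k L ⁅y, J z⁆ w = killingForm k L ⁅y, z⁆ (J w) := by
    intro y z w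
    obtain ⟨x, rfl⟩ := hsurj y
    have inv : ∀ a b c : L, killingForm k L ⁅a, b⁆ c = - killingForm k L b ⁅a, c⁆ :=
      fun a b c => LieModule.traceForm_apply_lie_apply' k L L a b c
    rw [hJ, inv, inv, hJ]
  have comm : ∀ x y : L, ⁅J x, y⁆ = ⁅x, J y⁆ := by
    intro x y
    apply sep
    intro w
    rw [key, ← lie_skew, ← lie_skew x y, map_neg, map_neg, LinearMap.neg_apply,
      LinearMap.neg_apply, key]
  refine ⟨?_, comm⟩
  ext x
  apply cen
  intro w
  rw [LinearMap.comp_apply, comm, hJ, LinearMap.id_apply]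
end

section
/- Every Lie-orthogonal operator on a finite-dimensional simple Lie algebra over an algebraically closed field of characteristic zero is either Id or −Id. -/
theorem lieOrthogonal_simple_trivial {k L : Type*} [Field k] [IsAlgClosed k] [CharZero k]
    [LieRing L] [LieAlgebra k L] [FiniteDimensional k L] [LieAlgebra.IsSimple k L]
    (J : L →ₗ[k] L) (hJ : ∀ x y : L, ⁅J x, J y⁆ = ⁅x, y⁆) :
    J = LinearMap.id ∨ J = -LinearMap.id := by
  have hK : LieAlgebra.IsKilling k L := inferInstance
  have hcen : ∀ x : L, (∀ y : L, ⁅x, y⁆ = 0) → x = 0 := by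
    intro x hx
    have h : x ∈ LieAlgebra.center k L := by
      rw [LieModule.mem_maxTrivSubmodule]
      intro y
      rw [← lie_skew, hx, neg_zero]
    rw [LieAlgebra.center_eq_bot] at h
    simpa using h
  have hinj : Function.Injective J := by
    rw [injective_iff_map_eq_zero]
    intro x hx
    apply hcen
    intro y
    rw [← hJ, hx, zero_lie]
  have hsurj : Function.Surjective J := LinearMap.injective_iff_surjective.mp hinj
  -- J² = 1
  have hinv : ∀ x, J (J x) = x := by
    intro x
    obtain ⟨e, he⟩ : ∃ e : L ≃ₗ[k] L, ∀ x, e x = J x :=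
      ⟨LinearEquiv.ofBijective J ⟨hinj, hsurj⟩, fun _ => rfl⟩
    have h1 : ∀ x y, ⁅J x, y⁆ = ⁅x, e.symm y⁆ := by
      intro x y
      rw [← hJ x, ← he (e.symm y), e.apply_symm_apply]
    have h2 : ∀ x y, ⁅e.symm x, y⁆ = ⁅x, J y⁆ := by
      intro x y
      rw [← hJ (e.symm x), ← he (e.symm x), e.apply_symm_apply]
    let S : L → L := fun x => J x - e.symm x
    have hS : ∀ x y, ⁅S x, y⁆ = ⁅S y, x⁆ := by
      intro x y
      simp only [S, sub_lie]
      rw [h1, h2, ← lie_skew, ← lie_skew x (J y)]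
      abel
    let f : L → L → L → k := fun x y z => killingForm k L ⁅S x, y⁆ z
    have f12 : ∀ x y z, f x y z = f y x z := by
      intro x y z
      simp only [f, hS x y]
    have f23 : ∀ x y z, f x y z = - f x z y := by
      intro x y z
      simp only [f]
      rw [LieModule.traceForm_apply_lie_apply, LieModule.traceForm_apply_lie_apply, ← lie_skew,
        map_neg]
    have f0 : ∀ x y z, f x y z = 0 := by
      intro x y z
      have : f x y z = - f x y z := by
        calc f x y z = - f x z y := f23 ..
          _ = - f z x y := by rw [f12]
          _ = f z y x := by rw [f23 z x y, neg_neg]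
          _ = f y z x := f12 ..
          _ = - f y x z := f23 ..
          _ = - f x y z := by rw [f12]
      exact self_eq_neg.mp this
    have hS0 : ∀ x, S x = 0 := by
      intro x
      apply hcen
      intro y
      have : ⁅S x, y⁆ ∈ LinearMap.ker (killingForm k L) := by
        rw [LinearMap.mem_ker]
        ext z
        exact f0 x y z
      rw [LieAlgebra.IsKilling.ker_killingForm_eq_bot] at this
      simpa using this
    have := hS0 (J x)
    simp only [S] at this
    rw [← he x, e.symm_apply_apply, sub_eq_zero, he] at this
    exact this
  have hcom : ∀ x y, J x = x → J y = -y → ⁅x, y⁆ = 0 := by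
    intro x y hx hy
    have := hJ x y
    rw [hx, hy, lie_neg] at this
    have : ⁅x, y⁆ = -⁅x, y⁆ := this.symm
    have h2 : (2 : k) • ⁅x, y⁆ = 0 := by
      rw [two_smul]; exact add_eq_zero_iff_eq_neg.mpr this
    simpa using h2
  have hdec : ∀ y, ∃ a b, J a = a ∧ J b = -b ∧ y = a + b := by
    intro y
    refine ⟨(2⁻¹ : k) • (y + J y), (2⁻¹ : k) • (y - J y), ?_, ?_, ?_⟩
    · rw [map_smul, map_add, hinv, add_comm]
    · rw [map_smul, map_sub, hinv, ← smul_neg, neg_sub]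
    · rw [← smul_add]
      have : y + J y + (y - J y) = (2 : k) • y := by rw [two_smul]; abel
      rw [this, smul_smul]; simp
  have hchar : ∀ x, (∀ b, J b = -b → ⁅x, b⁆ = 0) → J x = x := by
    intro x hx
    obtain ⟨a, b, ha, hb, rfl⟩ := hdec x
    have hb0 : b = 0 := by
      apply hcen
      intro y
      obtain ⟨c, d, hc, hd, rfl⟩ := hdec y
      have h := hx d hd
      rw [add_lie, hcom a d ha hd, zero_add] at h
      rw [lie_add, h, ← lie_skew, hcom c b hc hb]
      simp
    rw [hb0, add_zero, ha]
  let I : LieIdeal k L :=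
    { LinearMap.ker (J - LinearMap.id) with
      lie_mem := by
        intro x m hm
        have hm' : J m = m := by
          have : J m - m = 0 := hm
          exact sub_eq_zero.mp this
        have : J ⁅x, m⁆ = ⁅x, m⁆ := by
          obtain ⟨c, d, hc, hd, rfl⟩ := hdec x
          apply hchar
          intro b hb
          have hdm : ⁅d, m⁆ = 0 := by rw [← lie_skew, hcom m d hm' hd, neg_zero]
          rw [add_lie, hdm, add_zero, lie_lie, hcom m b hm' hb, hcom c b hc hb]
          simp
        change J ⁅x, m⁆ - ⁅x, m⁆ = 0
        rw [this, sub_self] }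
  have hI : ∀ x, x ∈ I ↔ J x = x := by
    intro x
    change J x - x = 0 ↔ _
    exact sub_eq_zero
  rcases LieAlgebra.IsSimple.eq_bot_or_eq_top I with h | h
  · right
    ext x
    obtain ⟨a, b, ha, hb, rfl⟩ := hdec x
    have : a ∈ I := (hI a).mpr ha
    rw [h] at this
    have ha0 : a = 0 := by simpa using this
    simp [ha0, hb]
  · left
    ext x
    have : x ∈ I := by rw [h]; trivial
    exact (hI x).mp this
end
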